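/- Let d ≥ 2 and M ≥ 1 be integers, and let α = 9/10 if d = 2 and α = (3/4)^d if d ≥ 3. Then for all integers k ≥ 1 and t ≥ 1, G(t + M, k) ≤ α^(d^⌊(t-1)/M⌋) · G(t, k). -/

import Mathlib

/-- The vertices of the rooted `d`-ary tree of depth `k`: sequences over `Fin d`
of length at most `k`.  The root is the empty sequence, the children of a vertex
`l` with `l.length < k` are the vertices `l ++ [j]` for `j : Fin d`, and the
leaves are the vertices of length exactly `k`. -/
abbrev Vtx (d k : ℕ) : Type := {l : List (Fin d) // l.length ≤ k}

/-- The root `v₀` of the tree. -/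
def rootV (d k : ℕ) : Vtx d k := ⟨[], by simp⟩

/-- `L_M(d,k)`: the set of integer-valued `M`-Lipschitz functions on the
`d`-ary tree of depth `k` that vanish on all leaves. -/
def LM (d k M : ℕ) : Set (Vtx d k → ℤ) :=
  {f | (∀ v : Vtx d k, v.1.length = k → f v = 0) ∧
       (∀ (l : List (Fin d)) (hl : l.length + 1 ≤ k) (j : Fin d),
         |f ⟨l ++ [j], by simpa using hl⟩ - f ⟨l, Nat.le_of_succ_le hl⟩| ≤ (M : ℤ))}

/-- `G(t,k)`: the number of functions in `L_M(d,k)` whose value at the root is `t`. -/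
noncomputable def G (d k M : ℕ) (t : ℤ) : ℕ :=
  Nat.card {f : Vtx d k → ℤ // f ∈ LM d k M ∧ f (rootV d k) = t}

/-- The probability that a uniformly random element of `L_M(d,k)` takes the
value `t` at the root. -/
noncomputable def PrRoot (d k M : ℕ) (t : ℤ) : ℝ :=
  (G d k M t : ℝ) / (Nat.card (LM d k M) : ℝ)

/-- The sum of `g` over the integer window of radius `M` around `t`. -/
noncomputable def window (M : ℤ) (g : ℤ → ℝ) (t : ℤ) : ℝ := ∑ s ∈ Finset.Icc (t - M) (t + M), g s

/-- Even functions that are nonincreasing in the absolute value of the argument. -/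
def EvenUnimodal (g : ℤ → ℝ) : Prop := ∀ x y : ℤ, |x| ≤ |y| → g y ≤ g x

theorem sum_Icc_consecutive_int (g : ℤ → ℝ) {a b c : ℤ} (hab : a ≤ b + 1) (hbc : b ≤ c) :
    ∑ s ∈ Finset.Icc a c, g s = ∑ s ∈ Finset.Icc a b, g s + ∑ s ∈ Finset.Icc (b + 1) c, g s := by
  rw [← Finset.sum_union]
  · congr 1
    ext x
    simp only [Finset.mem_Icc, Finset.mem_union]
    omega
  · rw [Finset.disjoint_left]
    intro x
    simp only [Finset.mem_Icc]
    omega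

theorem sum_Icc_shift_int (g : ℤ → ℝ) {a b a' b' : ℤ} (c : ℤ) (ha : a' = a + c)
    (hb : b' = b + c) :
    ∑ s ∈ Finset.Icc a' b', g s = ∑ s ∈ Finset.Icc a b, g (s + c) := by
  refine Finset.sum_nbij' (fun x => x - c) (fun x => x + c) ?_ ?_ ?_ ?_ ?_ <;>
    intro x hx <;> simp only [Finset.mem_Icc, sub_add_cancel, add_sub_cancel_right] at hx ⊢ <;> omega

theorem sum_Icc_neg_int (g : ℤ → ℝ) {a b a' b' : ℤ} (ha : a' = -b) (hb : b' = -a) :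
    ∑ s ∈ Finset.Icc a' b', g s = ∑ s ∈ Finset.Icc a b, g (-s) := by
  refine Finset.sum_nbij' (fun x => -x) (fun x => -x) ?_ ?_ ?_ ?_ ?_ <;>
    intro x hx <;> simp only [Finset.mem_Icc, neg_neg] at hx ⊢ <;> omega

theorem EvenUnimodal.neg_apply {g : ℤ → ℝ} (hg : EvenUnimodal g) (t : ℤ) : g (-t) = g t :=
  le_antisymm (hg _ _ (abs_neg t).ge) (hg _ _ (abs_neg t).le)

theorem EvenUnimodal.anti {g : ℤ → ℝ} (hg : EvenUnimodal g) {x y : ℤ} (hx : 0 ≤ x)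
    (hxy : x ≤ y) : g y ≤ g x :=
  hg _ _ (by rwa [abs_of_nonneg hx, abs_of_nonneg (hx.trans hxy)])

theorem window_nonneg {M : ℤ} {g : ℤ → ℝ} (h0 : ∀ t, 0 ≤ g t) (t : ℤ) : 0 ≤ window M g t :=
  Finset.sum_nonneg fun s _ => h0 s

theorem window_neg {M : ℤ} {g : ℤ → ℝ} (hg : EvenUnimodal g) (t : ℤ) :
    window M g (-t) = window M g t := by
  unfold window
  rw [sum_Icc_neg_int g (a := t - M) (b := t + M) (by ring) (by ring)]
  exact Finset.sum_congr rfl fun s _ => hg.neg_apply s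

theorem EvenUnimodal.window {M : ℤ} (hM : 1 ≤ M) {g : ℤ → ℝ} (hg : EvenUnimodal g) :
    EvenUnimodal (window M g) := by
  have step : ∀ t : ℤ, 0 ≤ t → _root_.window M g (t + 1) ≤ _root_.window M g t := by
    intro t ht
    have h1 := sum_Icc_consecutive_int g (a := t - M) (b := t - M) (c := t + M + 1)
      (by omega) (by omega)
    have h2 := sum_Icc_consecutive_int g (a := t - M) (b := t + M) (c := t + M + 1)
      (by omega) (by omega)
    rw [Finset.Icc_self, Finset.sum_singleton] at h1 h2
    have h3 : g (t + M + 1) ≤ g (t - M) := by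
      apply hg
      rw [abs_le, abs_of_nonneg (by omega : 0 ≤ t + M + 1)]
      omega
    unfold _root_.window
    rw [show t + 1 - M = t - M + 1 by ring, show t + 1 + M = t + M + 1 by ring]
    linarith
  have anti : ∀ x : ℤ, 0 ≤ x → ∀ y, x ≤ y → _root_.window M g y ≤ _root_.window M g x := by
    intro x hx y hxy
    induction y, hxy using Int.leInduction with
    | base => exact le_rfl
    | succ n hn ih => exact (step n (hx.trans hn)).trans ih
  have habs : ∀ x : ℤ, _root_.window M g |x| = _root_.window M g x := by
    intro x
    rcases abs_choice x with h | h <;> rw [h]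
    exact window_neg hg x
  intro x y hxy
  rw [← habs x, ← habs y]
  exact anti _ (abs_nonneg x) _ hxy

theorem EvenUnimodal.pow {g : ℤ → ℝ} (hg : EvenUnimodal g) (h0 : ∀ t, 0 ≤ g t) (d : ℕ) :
    EvenUnimodal fun t => g t ^ d :=
  fun x y hxy => pow_le_pow_left₀ (h0 y) (hg x y hxy) d

/-- The window around `s + M`, cut at `M`, `M + s` and `2 * M`. -/
theorem window_add_eq {M s : ℤ} (g : ℤ → ℝ) (h1 : 1 ≤ s) (hs : s ≤ M) :
    window M g (s + M) = g s + ∑ j ∈ Finset.Icc (s + 1) M, g j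
      + ∑ j ∈ Finset.Icc 1 s, g (j + M) + ∑ j ∈ Finset.Icc (s + 1) M, g (j + M)
      + ∑ j ∈ Finset.Icc (M + 1) (M + s), g (j + M) := by
  unfold window
  rw [sum_Icc_consecutive_int g (b := s) (by omega) (by omega),
    sum_Icc_consecutive_int g (a := s + 1) (b := M) (by omega) (by omega),
    sum_Icc_consecutive_int g (a := M + 1) (b := M + s) (by omega) (by omega),
    sum_Icc_consecutive_int g (a := M + s + 1) (b := M + M) (by omega) (by omega),
    sum_Icc_shift_int g (a := 1) (b := s) (a' := M + 1) M (by ring) (by ring),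
    sum_Icc_shift_int g (a := s + 1) (b := M) (a' := M + s + 1) M (by ring) (by ring),
    sum_Icc_shift_int g (a := M + 1) (b := M + s) (a' := M + M + 1) M (by ring) (by ring),
    add_sub_cancel_right, Finset.Icc_self, Finset.sum_singleton]
  ring

theorem le_window {M s : ℤ} {g : ℤ → ℝ} (hg : EvenUnimodal g) (h1 : 1 ≤ s) (hs : s ≤ M) :
    g s + 2 * ∑ j ∈ Finset.Icc (s + 1) M, g j + ∑ j ∈ Finset.Icc 1 s, g j
      + ∑ j ∈ Finset.Icc 1 s, g (j + M) ≤ window M g s := by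
  have hrefl : g s + ∑ j ∈ Finset.Icc (s + 1) M, g j ≤ ∑ j ∈ Finset.Icc (s - M) 0, g j := by
    have hsplit := sum_Icc_consecutive_int g (a := s) (b := s) (c := M) (by omega) hs
    rw [Finset.Icc_self, Finset.sum_singleton] at hsplit
    rw [← hsplit, sum_Icc_neg_int g (a := 0) (b := M - s) (a' := s - M) (b' := 0) (by ring) (by ring),
      sum_Icc_shift_int g (a := 0) (b := M - s) (a' := s) (b' := M) s (by ring) (by ring)]
    refine Finset.sum_le_sum fun j hj => ?_
    rw [Finset.mem_Icc] at hj
    rw [hg.neg_apply]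
    exact hg.anti hj.1 (by omega)
  unfold window
  rw [sum_Icc_consecutive_int g (a := s - M) (b := 0) (by omega) (by omega),
    sum_Icc_consecutive_int g (a := 0 + 1) (b := s) (by omega) (by omega),
    sum_Icc_consecutive_int g (a := s + 1) (b := M) (c := s + M) (by omega) (by omega),
    sum_Icc_shift_int g (a := 1) (b := s) (a' := M + 1) (b' := s + M) M (by ring) (by ring),
    zero_add]
  linarith

theorem sum_shift_le {M a b : ℤ} {g : ℤ → ℝ} {c : ℝ}
    (h : ∀ j, a ≤ j → j ≤ b → g (j + M) ≤ c * g j) :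
    ∑ j ∈ Finset.Icc a b, g (j + M) ≤ c * ∑ j ∈ Finset.Icc a b, g j := by
  rw [Finset.mul_sum]
  refine Finset.sum_le_sum fun j hj => ?_
  rw [Finset.mem_Icc] at hj
  exact h j hj.1 hj.2

theorem sum_outer_le {M s : ℤ} {g : ℤ → ℝ} {c : ℝ} (hs : s ≤ M)
    (h : ∀ j, M + 1 ≤ j → j ≤ 2 * M → g (j + M) ≤ c * g j) :
    ∑ j ∈ Finset.Icc (M + 1) (M + s), g (j + M) ≤ c * ∑ j ∈ Finset.Icc 1 s, g (j + M) := by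
  rw [← sum_Icc_shift_int g (a := 1) (b := s) (a' := M + 1) (b' := M + s) M (by ring) (by ring)]
  exact sum_shift_le fun j h1 h2 => h j h1 (by omega)

theorem window_add_le_of_average {M s : ℤ} {g : ℤ → ℝ} {γ c θ : ℝ} (hg : EvenUnimodal g)
    (h0 : ∀ t, 0 ≤ g t) (h1 : 1 ≤ s) (hs : s ≤ M)
    (hγ : ∑ j ∈ Finset.Icc 1 M, g (j + M) ≤ γ * ∑ j ∈ Finset.Icc 1 M, g j)
    (hc : ∀ j, M + 1 ≤ j → j ≤ 2 * M → g (j + M) ≤ c * g j)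
    (hγθ : (1 + γ) / 2 ≤ θ) (hcθ : c ≤ θ) (hθ : θ ≤ 1) (hθ0 : 0 ≤ θ) :
    window M g (s + M) ≤ θ * window M g s := by
  have hw := sum_outer_le hs hc
  have hle := mul_le_mul_of_nonneg_left (le_window hg h1 hs) hθ0
  rw [window_add_eq g h1 hs]
  rw [sum_Icc_consecutive_int g (b := s) (by omega) hs,
    sum_Icc_consecutive_int (fun j => g (j + M)) (b := s) (by omega) hs] at hγ
  have hQ : g s ≤ ∑ j ∈ Finset.Icc 1 s, g j :=
    Finset.single_le_sum (f := g) (fun j _ => h0 j) (by simp [h1])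
  have hP : 0 ≤ ∑ j ∈ Finset.Icc (s + 1) M, g j := Finset.sum_nonneg fun j _ => h0 j
  have hr : 0 ≤ ∑ j ∈ Finset.Icc 1 s, g (j + M) := Finset.sum_nonneg fun j _ => h0 _
  have hcr := mul_le_mul_of_nonneg_right hcθ hr
  have hs0 := h0 s
  generalize ∑ j ∈ Finset.Icc (s + 1) M, g j = P at *
  generalize ∑ j ∈ Finset.Icc 1 s, g j = Q at *
  have e1 := mul_le_mul_of_nonneg_right hγθ (add_nonneg hP (hs0.trans hQ))
  have e2 := mul_le_mul_of_nonneg_left hQ (sub_nonneg.2 hθ)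
  linarith

theorem window_add_le_of_decay {M s : ℤ} {g : ℤ → ℝ} (hg : EvenUnimodal g)
    (h0 : ∀ t, 0 ≤ g t) (h1 : 1 ≤ s) (hs : s ≤ M)
    (hα : ∀ j, 1 ≤ j → j ≤ M → g (j + M) ≤ (9 / 10) * g j)
    (hc : ∀ j, M + 1 ≤ j → j ≤ 2 * M → g (j + M) ≤ (81 / 100) * g j) :
    window M g (s + M) ≤ (19 / 20) * window M g s ∧
      (M ≤ 2 * s → window M g (s + M) ≤ (37 / 40) * window M g s) := by
  have hw := sum_outer_le hs hc
  have hle := le_window hg h1 hs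
  have hQ : g s ≤ ∑ j ∈ Finset.Icc 1 s, g j :=
    Finset.single_le_sum (f := g) (fun j _ => h0 j) (by simp [h1])
  have hr : ∑ j ∈ Finset.Icc 1 s, g (j + M) ≤ (9 / 10) * ∑ j ∈ Finset.Icc 1 s, g j :=
    sum_shift_le fun j a b => hα j a (b.trans hs)
  have hB : ∑ j ∈ Finset.Icc (s + 1) M, g (j + M) ≤ (9 / 10) * ∑ j ∈ Finset.Icc (s + 1) M, g j :=
    sum_shift_le fun j a b => hα j (by omega) b
  have hP : 0 ≤ ∑ j ∈ Finset.Icc (s + 1) M, g j := Finset.sum_nonneg fun j _ => h0 j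
  have hs0 := h0 s
  rw [window_add_eq g h1 hs]
  refine ⟨by linarith, fun hMs => ?_⟩
  have hPQ : ∑ j ∈ Finset.Icc (s + 1) M, g j ≤ ∑ j ∈ Finset.Icc 1 s, g j := by
    have hu : ∑ j ∈ Finset.Icc (s + 1) M, g j ≤ ∑ j ∈ Finset.Icc (s + 1) M, g s :=
      Finset.sum_le_sum fun j hj => hg.anti (by omega) (by rw [Finset.mem_Icc] at hj; omega)
    have hl : ∑ j ∈ Finset.Icc 1 s, g s ≤ ∑ j ∈ Finset.Icc 1 s, g j :=
      Finset.sum_le_sum fun j hj => by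
        rw [Finset.mem_Icc] at hj
        exact hg.anti (by omega) (by omega)
    rw [Finset.sum_const, nsmul_eq_mul, Int.card_Icc] at hu hl
    have hcard : (((M + 1 - (s + 1)).toNat : ℕ) : ℝ) ≤ ((s + 1 - 1).toNat : ℕ) := by
      exact_mod_cast (by omega : (M + 1 - (s + 1)).toNat ≤ (s + 1 - 1).toNat)
    exact hu.trans ((mul_le_mul_of_nonneg_right hcard hs0).trans hl)
  linarith

/-- Pointwise decay that improves on the upper half of `[1, M]` gives averaged decay. -/
theorem average_decay {M : ℤ} (hM : 1 ≤ M) {f : ℤ → ℝ} (hf : EvenUnimodal f)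
    (h0 : ∀ t, 0 ≤ f t)
    (h : ∀ s, 1 ≤ s → s ≤ M → f (s + M) ≤ (19 / 20) ^ 2 * f s)
    (h' : ∀ s, 1 ≤ s → s ≤ M → M ≤ 2 * s → f (s + M) ≤ (37 / 40) ^ 2 * f s) :
    ∑ j ∈ Finset.Icc 1 M, f (j + M) ≤ (8972 / 10000) * ∑ j ∈ Finset.Icc 1 M, f j := by
  have hB : ∑ j ∈ Finset.Icc 1 M, f (j + M) ≤ ∑ j ∈ Finset.Icc 1 M, f M :=
    Finset.sum_le_sum fun j hj => hf.anti (by omega) (by rw [Finset.mem_Icc] at hj; omega)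
  have hA : ∑ j ∈ Finset.Icc (M / 2 + 1) M, f M ≤ ∑ j ∈ Finset.Icc (M / 2 + 1) M, f j :=
    Finset.sum_le_sum fun j hj => by
      rw [Finset.mem_Icc] at hj
      exact hf.anti (by omega) (by omega)
  rw [Finset.sum_const, nsmul_eq_mul, Int.card_Icc] at hB hA
  have hcard : (((M + 1 - 1).toNat : ℕ) : ℝ) ≤ 2 * ((M + 1 - (M / 2 + 1)).toNat : ℕ) := by
    exact_mod_cast (by omega : (M + 1 - 1).toNat ≤ 2 * (M + 1 - (M / 2 + 1)).toNat)
  have hBA := hB.trans (mul_le_mul_of_nonneg_right hcard (h0 M))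
  have hlow : ∑ j ∈ Finset.Icc 1 (M / 2), f (j + M)
      ≤ (19 / 20) ^ 2 * ∑ j ∈ Finset.Icc 1 (M / 2), f j :=
    sum_shift_le fun j a b => h j a (by omega)
  have hhigh : ∑ j ∈ Finset.Icc (M / 2 + 1) M, f (j + M)
      ≤ (37 / 40) ^ 2 * ∑ j ∈ Finset.Icc (M / 2 + 1) M, f j :=
    sum_shift_le fun j a b => h' j (by omega) b (by omega)
  rw [sum_Icc_consecutive_int (fun j => f (j + M)) (b := M / 2) (by omega) (by omega)] at hBA ⊢
  rw [sum_Icc_consecutive_int f (b := M / 2) (by omega) (by omega)]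
  have p1 : 0 ≤ ∑ j ∈ Finset.Icc 1 (M / 2), f j := Finset.sum_nonneg fun j _ => h0 j
  have p2 : 0 ≤ ∑ j ∈ Finset.Icc (M / 2 + 1) M, f j := Finset.sum_nonneg fun j _ => h0 j
  linarith

/-- Doubly exponential decay of `g` along steps of length `M`. -/
def DoublyExpDecay (d : ℕ) (M : ℤ) (α : ℝ) (g : ℤ → ℝ) : Prop :=
  ∀ t : ℤ, 1 ≤ t → g (t + M) ≤ α ^ (d ^ ((t - 1) / M).toNat) * g t

theorem DoublyExpDecay.of_le {d : ℕ} {M : ℤ} {α : ℝ} {g : ℤ → ℝ} (hg : DoublyExpDecay d M α g)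
    {j : ℤ} (h1 : 1 ≤ j) (hj : j ≤ M) : g (j + M) ≤ α * g j := by
  have := hg j h1
  rwa [Int.ediv_eq_zero_of_lt (by omega) (by omega), Int.toNat_zero, pow_zero, pow_one] at this

theorem DoublyExpDecay.of_pow_le {d : ℕ} (hd : 1 ≤ d) {M : ℤ} (hM : 1 ≤ M) {α : ℝ} (hα0 : 0 ≤ α)
    (hα1 : α ≤ 1) {g : ℤ → ℝ} (h0 : ∀ t, 0 ≤ g t) (hg : DoublyExpDecay d M α g) {n : ℕ} {j : ℤ}
    (h1 : n * M + 1 ≤ j) : g (j + M) ≤ α ^ d ^ n * g j := by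
  have hn : (0 : ℤ) ≤ n * M := by positivity
  refine (hg j (by omega)).trans (mul_le_mul_of_nonneg_right ?_ (h0 j))
  refine pow_le_pow_of_le_one hα0 hα1 (Nat.pow_le_pow_right hd ?_)
  have : (n : ℤ) ≤ (j - 1) / M := by
    rw [Int.le_ediv_iff_mul_le (by omega)]
    omega
  omega

theorem DoublyExpDecay.window_pow {d : ℕ} (hd : 1 ≤ d) {M : ℤ} (hM : 1 ≤ M) {α : ℝ} (hα0 : 0 ≤ α)
    (hα1 : α ≤ 1) {g : ℤ → ℝ} (h0 : ∀ t, 0 ≤ g t) (hg : DoublyExpDecay d M α g)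
    (hbase : ∀ s, 1 ≤ s → s ≤ M → window M g (s + M) ^ d ≤ α * window M g s ^ d) :
    DoublyExpDecay d M α fun t => window M g t ^ d := by
  intro t ht
  rcases le_or_gt t M with htM | htM
  · rw [Int.ediv_eq_zero_of_lt (by omega) (by omega), Int.toNat_zero, pow_zero, pow_one]
    exact hbase t ht htM
  obtain ⟨n, hn⟩ : ∃ n : ℕ, (t - 1) / M = n + 1 := by
    have : 1 ≤ (t - 1) / M := by
      rw [Int.le_ediv_iff_mul_le (by omega)]
      omega
    exact ⟨((t - 1) / M - 1).toNat, by omega⟩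
  have hnM : (n + 1 : ℤ) * M ≤ t - 1 := by
    rw [← hn]
    exact Int.ediv_mul_le _ (by omega)
  have hw : _root_.window M g (t + M) ≤ α ^ d ^ n * _root_.window M g t := by
    unfold _root_.window
    rw [sum_Icc_shift_int g (a := t - M) (b := t + M) M (by ring) (by ring)]
    exact sum_shift_le fun j a _ => hg.of_pow_le hd hM hα0 hα1 h0 (by linarith)
  have := pow_le_pow_left₀ (window_nonneg h0 _) hw d
  rw [mul_pow, ← pow_mul, ← pow_succ] at this
  rwa [hn, show ((n : ℤ) + 1).toNat = n + 1 by omega]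

/-- The recursion satisfied by the number of Lipschitz functions with a given root value. -/
noncomputable def rootCount (d : ℕ) (M : ℤ) : ℕ → ℤ → ℝ
  | 0 => fun t => if t = 0 then 1 else 0
  | k + 1 => fun t => window M (rootCount d M k) t ^ d

theorem rootCount_nonneg (d : ℕ) (M : ℤ) (k : ℕ) (t : ℤ) : 0 ≤ rootCount d M k t := by
  induction k generalizing t with
  | zero => unfold rootCount; split_ifs <;> norm_num
  | succ k ih => exact pow_nonneg (window_nonneg ih t) d

theorem rootCount_evenUnimodal (d : ℕ) {M : ℤ} (hM : 1 ≤ M) (k : ℕ) :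
    EvenUnimodal (rootCount d M k) := by
  induction k with
  | zero =>
    intro x y hxy
    unfold rootCount
    by_cases hy : y = 0
    · have : x = 0 := by simpa [hy] using hxy
      simp [hy, this]
    · rw [if_neg hy]
      split_ifs <;> norm_num
  | succ k ih => exact (ih.window hM).pow (window_nonneg (rootCount_nonneg d M k)) d

theorem rootCount_zero_of_pos (d : ℕ) (M : ℤ) {t : ℤ} (ht : 1 ≤ t) : rootCount d M 0 t = 0 :=
  if_neg (by omega)

theorem rootCount_zero_decay (d : ℕ) {M : ℤ} (hM : 1 ≤ M) (α : ℝ) :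
    DoublyExpDecay d M α (rootCount d M 0) := by
  intro t ht
  rw [rootCount_zero_of_pos d M (by omega), rootCount_zero_of_pos d M ht, mul_zero]

theorem rootCount_decay_two {M : ℤ} (hM : 1 ≤ M) (k : ℕ) :
    DoublyExpDecay 2 M (9 / 10) (rootCount 2 M k) ∧
      ∑ j ∈ Finset.Icc 1 M, rootCount 2 M k (j + M)
        ≤ (8972 / 10000) * ∑ j ∈ Finset.Icc 1 M, rootCount 2 M k j := by
  induction k with
  | zero =>
    refine ⟨rootCount_zero_decay 2 hM _, sum_shift_le fun j h1 _ => ?_⟩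
    rw [rootCount_zero_of_pos 2 M (by omega), rootCount_zero_of_pos 2 M h1, mul_zero]
  | succ k ih =>
    obtain ⟨hdec, havg⟩ := ih
    have h0 := rootCount_nonneg 2 M k
    have hu := rootCount_evenUnimodal 2 hM k
    have hc : ∀ j, M + 1 ≤ j → j ≤ 2 * M →
        rootCount 2 M k (j + M) ≤ (81 / 100) * rootCount 2 M k j := by
      intro j hj _
      have := hdec.of_pow_le (n := 1) (by norm_num) hM (by norm_num) (by norm_num) h0
        (j := j) (by push_cast; omega)
      norm_num at this
      exact this
    have hfine := fun s h1 hs =>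
      window_add_le_of_decay (s := s) hu h0 h1 hs (fun j => hdec.of_le) hc
    have hw := fun s => window_nonneg (M := M) h0 s
    constructor
    · refine hdec.window_pow (by norm_num) hM (by norm_num) (by norm_num) h0 fun s h1 hs => ?_
      have hle := window_add_le_of_average (θ := 9486 / 10000) hu h0 h1 hs havg hc
        (by norm_num) (by norm_num) (by norm_num) (by norm_num)
      have hsq := pow_le_pow_left₀ (hw _) hle 2
      rw [mul_pow] at hsq
      exact hsq.trans (mul_le_mul_of_nonneg_right (by norm_num) (sq_nonneg _))
    · refine average_decay hM (rootCount_evenUnimodal 2 hM (k + 1)) (rootCount_nonneg 2 M (k + 1))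
        (fun s h1 hs => ?_) (fun s h1 hs hMs => ?_)
      · have hsq := pow_le_pow_left₀ (hw _) (hfine s h1 hs).1 2
        rwa [mul_pow] at hsq
      · have hsq := pow_le_pow_left₀ (hw _) ((hfine s h1 hs).2 hMs) 2
        rwa [mul_pow] at hsq

theorem rootCount_decay_of_three_le {d : ℕ} (hd : 3 ≤ d) {M : ℤ} (hM : 1 ≤ M) (k : ℕ) :
    DoublyExpDecay d M ((3 / 4) ^ d) (rootCount d M k) := by
  have hα0 : (0 : ℝ) ≤ (3 / 4) ^ d := by positivity
  have hα : ((3 : ℝ) / 4) ^ d ≤ 27 / 64 :=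
    (pow_le_pow_of_le_one (by norm_num) (by norm_num) hd).trans (by norm_num)
  induction k with
  | zero => exact rootCount_zero_decay d hM _
  | succ k ih =>
    have h0 := rootCount_nonneg d M k
    have hu := rootCount_evenUnimodal d hM k
    refine ih.window_pow (by omega) hM hα0 (by linarith) h0 fun s h1 hs => ?_
    have hdec : ∀ j, 1 ≤ j → rootCount d M k (j + M) ≤ (27 / 64) * rootCount d M k j := by
      intro j hj
      have := ih.of_pow_le (n := 0) (by omega) hM hα0 (by linarith) h0 (j := j)
        (by push_cast; omega)
      rw [pow_zero, pow_one] at this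
      exact this.trans (mul_le_mul_of_nonneg_right hα (h0 j))
    have hle := window_add_le_of_average (γ := 27 / 64) (c := 27 / 64) (θ := 3 / 4) hu h0 h1 hs
      (sum_shift_le fun j h _ => hdec j h) (fun j h _ => hdec j (by omega))
      (by norm_num) (by norm_num) (by norm_num) (by norm_num)
    have hpow := pow_le_pow_left₀ (window_nonneg h0 _) hle d
    rwa [mul_pow] at hpow

/-- Lipschitz functions on the tree of depth `k + 1` with root value `t` are families, indexed by
the children of the root, of Lipschitz functions on the subtrees of depth `k`. -/
def rootedEquiv (d k M : ℕ) (t : ℤ) :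
    {f : Vtx d (k + 1) → ℤ // f ∈ LM d (k + 1) M ∧ f (rootV d (k + 1)) = t} ≃
      (Fin d → {f : Vtx d k → ℤ // f ∈ LM d k M ∧ |f (rootV d k) - t| ≤ M}) where
  toFun f j := ⟨fun v => f.1 ⟨j :: v.1, Nat.succ_le_succ v.2⟩,
    ⟨fun v hv => f.2.1.1 _ (by simp [hv]),
      fun l hl i => f.2.1.2 (j :: l) (Nat.succ_le_succ hl) i⟩, by
      have h := f.2.1.2 [] (by simp) j
      have h' := f.2.2
      exact (congrArg (fun x => |f.1 _ - x| ≤ (M : ℤ)) h').mp h⟩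
  invFun F := ⟨fun v => match v with
      | ⟨[], _⟩ => t
      | ⟨j :: l, h⟩ => (F j).1 ⟨l, Nat.le_of_succ_le_succ h⟩,
    ⟨by
      rintro ⟨_ | ⟨j, l⟩, h⟩ hv
      · simp at hv
      · exact (F j).2.1.1 _ (by simpa using hv), by
      rintro (_ | ⟨j, l⟩) hl i
      · exact (F i).2.2
      · exact (F j).2.1.2 l (Nat.le_of_succ_le_succ hl) i⟩, rfl⟩
  left_inv f := by
    apply Subtype.ext
    funext v
    rcases v with ⟨_ | ⟨j, l⟩, h⟩
    · exact f.2.2.symm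
    · rfl
  right_inv F := rfl

/-- Classify the functions whose root value is within `M` of `t` by their root value. -/
def nearRootEquiv (d k M : ℕ) (t : ℤ) :
    {f : Vtx d k → ℤ // f ∈ LM d k M ∧ |f (rootV d k) - t| ≤ M} ≃
      Σ s : Finset.Icc (t - M) (t + M), {f : Vtx d k → ℤ // f ∈ LM d k M ∧ f (rootV d k) = s} where
  toFun f := ⟨⟨f.1 (rootV d k), by
    have := abs_le.1 f.2.2
    rw [Finset.mem_Icc]
    omega⟩, ⟨f.1, f.2.1, rfl⟩⟩
  invFun p := ⟨p.2.1, p.2.2.1, by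
    have := Finset.mem_Icc.1 p.1.2
    rw [p.2.2.2, abs_le]
    omega⟩
  left_inv _ := rfl
  right_inv := by
    rintro ⟨⟨s, hs⟩, f, hf, h⟩
    exact Sigma.subtype_ext (Subtype.ext h) rfl

theorem finite_rooted (d k M : ℕ) (t : ℤ) :
    Finite {f : Vtx d k → ℤ // f ∈ LM d k M ∧ f (rootV d k) = t} := by
  induction k generalizing t with
  | zero =>
    have : Subsingleton {f : Vtx d 0 → ℤ // f ∈ LM d 0 M ∧ f (rootV d 0) = t} := by
      refine ⟨fun f g => Subtype.ext (funext fun v => ?_)⟩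
      rw [f.2.1.1 v (Nat.le_zero.1 v.2), g.2.1.1 v (Nat.le_zero.1 v.2)]
    infer_instance
  | succ k ih =>
    have : Finite {f : Vtx d k → ℤ // f ∈ LM d k M ∧ |f (rootV d k) - t| ≤ M} :=
      Finite.of_equiv _ (nearRootEquiv d k M t).symm
    exact Finite.of_equiv _ (rootedEquiv d k M t).symm

theorem G_zero (d M : ℕ) (t : ℤ) : G d 0 M t = if t = 0 then 1 else 0 := by
  unfold G
  split_ifs with ht
  · rw [Nat.card_eq_one_iff_unique]
    refine ⟨⟨fun f g => Subtype.ext (funext fun v => ?_)⟩,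
      ⟨⟨fun _ => 0, ⟨fun _ _ => rfl, fun _ hl => absurd hl (by omega)⟩, ht.symm⟩⟩⟩
    rw [f.2.1.1 v (Nat.le_zero.1 v.2), g.2.1.1 v (Nat.le_zero.1 v.2)]
  · have : IsEmpty {f : Vtx d 0 → ℤ // f ∈ LM d 0 M ∧ f (rootV d 0) = t} :=
      ⟨fun f => ht (f.2.2.symm.trans (f.2.1.1 (rootV d 0) rfl))⟩
    exact Nat.card_of_isEmpty

theorem G_succ (d k M : ℕ) (t : ℤ) :
    G d (k + 1) M t = (∑ s ∈ Finset.Icc (t - M) (t + M), G d k M s) ^ d := by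
  have := fun s => finite_rooted d k M s
  unfold G
  rw [Nat.card_congr (rootedEquiv d k M t), Nat.card_fun, Nat.card_fin,
    Nat.card_congr (nearRootEquiv d k M t), Nat.card_sigma,
    Finset.sum_coe_sort (Finset.Icc (t - (M : ℤ)) (t + M))
      fun s => Nat.card {f : Vtx d k → ℤ // f ∈ LM d k M ∧ f (rootV d k) = s}]

theorem G_eq_rootCount (d k M : ℕ) (t : ℤ) : (G d k M t : ℝ) = rootCount d M k t := by
  induction k generalizing t with
  | zero => simp [G_zero, rootCount]
  | succ k ih => simp [G_succ, rootCount, window, ih]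

/-- **Full doubly-exponential bound on `G`.**  Let `α = 9/10` if `d = 2` and
`α = (3/4)^d` if `d ≥ 3`.  Then for all `k, t ≥ 1`,
`G(t+M,k) ≤ α^(d^⌊(t-1)/M⌋) * G(t,k)`. -/
theorem G_full_bound (d M : ℕ) (hd : 2 ≤ d) (hM : 1 ≤ M) (α : ℝ)
    (hα : α = if d = 2 then (9 / 10 : ℝ) else (3 / 4 : ℝ) ^ d)
    (k : ℕ) (hk : 1 ≤ k) (t : ℤ) (ht : 1 ≤ t) :
    (G d k M (t + M) : ℝ) ≤ α ^ (d ^ ((t - 1) / (M : ℤ)).toNat) * (G d k M t : ℝ) := by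
  have hM' : (1 : ℤ) ≤ M := by exact_mod_cast hM
  rw [G_eq_rootCount, G_eq_rootCount, hα]
  split_ifs with h2
  · subst h2
    exact (rootCount_decay_two hM' k).1 t ht
  · exact rootCount_decay_of_three_le (by omega) hM' k t ht
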